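/- Let 𝔄 be a subshift, (G,·) a group with a finite-valued pseudonorm |·| (so |g| < ∞ for all g) additionally satisfying |g^(−1)| = |g|, and c a local rule of radius r for a G-valued cocycle on 𝔄 with |c(e,p)| ≤ 1 for all e ∈ E and p ∈ 𝔄_(r). Let a ∈ 𝔄̃ and assume: (path-independence) any two trails lying in G_r(a) with the same initial point and the same final point have equal values under c(·, a), so that for r-trail-connected points y, z one may set ∇_a(y,z) := c(ζ, a) for any trail ζ from z to y lying in G_r(a); (sharpness) for every R ≥ r there is K ∈ ℕ such that every y ∈ G_r(a) is joined, by a trail of length at most K lying in G_r(a), to some point of G_R(a); (no ramification) for every R' ≥ r there is R ≥ R' such that any two points of G_R(a) lying in the same trail-component of G_r(a) are joined by a trail lying in G_(R')(a). Let X and Y be two distinct projective trail-components of G_r(a), fix reference points x* ∈ X and y* ∈ Y, and for x ∈ X and y ∈ Y set ∇_a(x,y) := ∇_a(x,x*) · ( ∇_a(y,y*) )^(−1). If the boundary between X and Y is a gap, i.e. the supremum over x ∈ X, y ∈ Y of |∇_a(x,y)| / ‖x − y‖₁ is infinite, then the defect of a is essential. -/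

import Mathlib

open scoped ENNReal

namespace Defects

/-- The configuration space `A^(ℤ^D)`. -/
abbrev Config (D : ℕ) (A : Type) := (Fin D → ℤ) → A

variable {D : ℕ} {A : Type}

/-- The shift `σ^v`. -/
def shift (v : Fin D → ℤ) (a : Config D A) : Config D A := fun z => a (z + v)

/-- A subshift: a nonempty closed shift-invariant subset of `A^(ℤ^D)`. -/
def IsSubshift [TopologicalSpace A] (𝔄 : Set (Config D A)) : Prop :=
  𝔄.Nonempty ∧ IsClosed 𝔄 ∧ ∀ v : Fin D → ℤ, shift v '' 𝔄 = 𝔄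

/-- The cube `B(r) = [-r, r]^D ⊆ ℤ^D`. -/
def ballZ (D r : ℕ) : Set (Fin D → ℤ) := {w | ∀ i, |w i| ≤ (r : ℤ)}

/-- The `r`-block of `a` at `z`, as an element of `A^(B(r))`. -/
def blockAt (r : ℕ) (a : Config D A) (z : Fin D → ℤ) : ballZ D r → A :=
  fun w => a (z + w.1)

/-- The set `𝔄_(r)` of admissible `r`-blocks. -/
def admissibleBlocks (𝔄 : Set (Config D A)) (r : ℕ) : Set (ballZ D r → A) :=
  (fun a => blockAt r a 0) '' 𝔄

/-- `G_R(a)`: the set of `z` where the `R`-block of `a` is admissible. -/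
def goodSet (𝔄 : Set (Config D A)) (R : ℕ) (a : Config D A) : Set (Fin D → ℤ) :=
  {z | blockAt R a z ∈ admissibleBlocks 𝔄 R}

/-- `𝔄̃`: configurations having arbitrarily large admissible regions. -/
def almostAdmissible (𝔄 : Set (Config D A)) : Set (Config D A) :=
  {a | ∀ R : ℕ, (goodSet 𝔄 R a).Nonempty}

/-- The defect of `a` is removable if some `a' ∈ 𝔄` agrees with `a` on `G_r(a)`. -/
def Removable (𝔄 : Set (Config D A)) (a : Config D A) : Prop :=
  ∃ r : ℕ, ∃ a' ∈ 𝔄, ∀ z ∈ goodSet 𝔄 r a, a' z = a z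

/-- A cellular automaton: continuous and commuting with all shifts. -/
def IsCellularAutomaton [TopologicalSpace A] (Φ : Config D A → Config D A) : Prop :=
  Continuous Φ ∧ ∀ v : Fin D → ℤ, Φ ∘ shift v = shift v ∘ Φ

/-- `Φ` has radius `R`: `Φ(a)(z)` depends only on the `R`-block of `a` at `z`. -/
def HasRadius {B : Type} (Φ : Config D A → Config D B) (R : ℕ) : Prop :=
  ∀ a b : Config D A, ∀ z : Fin D → ℤ, blockAt R a z = blockAt R b z → Φ a z = Φ b z

/-- `E = {±e_1, …, ±e_D}`. -/
def stdSteps (D : ℕ) : Set (Fin D → ℤ) :=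
  {v | ∃ i : Fin D, v = Pi.single i 1 ∨ v = -Pi.single i 1}

/-- A subshift homomorphism `Φ : 𝔄 → 𝔅`. -/
def IsSubshiftHom {B : Type} [TopologicalSpace A] [TopologicalSpace B]
    (𝔄 : Set (Config D A)) (𝔅 : Set (Config D B)) (Φ : Config D A → Config D B) : Prop :=
  Set.MapsTo Φ 𝔄 𝔅 ∧ ContinuousOn Φ 𝔄 ∧
    ∀ v : Fin D → ℤ, ∀ a ∈ 𝔄, Φ (shift v a) = shift v (Φ a)

/-- `Φ` has radius `R` as a map on `𝔄`. -/
def HomHasRadius {B : Type} (𝔄 : Set (Config D A)) (Φ : Config D A → Config D B)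
    (R : ℕ) : Prop :=
  ∀ a ∈ 𝔄, ∀ a' ∈ 𝔄, ∀ z : Fin D → ℤ, blockAt R a z = blockAt R a' z → Φ a z = Φ a' z

/-! ### Dynamical cocycles (multiplicative) -/

/-- A continuous `G`-valued (dynamical) cocycle on `𝔄`. -/
def DynCocycleOn [TopologicalSpace A] {G : Type} [Group G] [TopologicalSpace G] (𝔄 : Set (Config D A))
    (C : (Fin D → ℤ) → Config D A → G) : Prop :=
  (∀ z : Fin D → ℤ, ContinuousOn (C z) 𝔄) ∧
    ∀ y z : Fin D → ℤ, ∀ a ∈ 𝔄, C (y + z) a = C y (shift z a) * C z a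

/-- Cohomologous cocycles, via a continuous transfer function. -/
def DynCohomologous [TopologicalSpace A] {G : Type} [Group G] [TopologicalSpace G] (𝔄 : Set (Config D A))
    (C C' : (Fin D → ℤ) → Config D A → G) : Prop :=
  ∃ b : Config D A → G, ContinuousOn b 𝔄 ∧
    ∀ z : Fin D → ℤ, ∀ a ∈ 𝔄, C' z a = b (shift z a) * C z a * (b a)⁻¹

/-- A trivial cocycle: cohomologous to a homomorphism `ℤ^D → G`. -/
def DynTrivial [TopologicalSpace A] {G : Type} [Group G] [TopologicalSpace G] (𝔄 : Set (Config D A))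
    (C : (Fin D → ℤ) → Config D A → G) : Prop :=
  ∃ h : (Fin D → ℤ) → G, (∀ y z : Fin D → ℤ, h (y + z) = h y * h z) ∧
    DynCohomologous 𝔄 C (fun z _ => h z)

/-- A cocycle is locally determined with radius `r` if `C(e, ·)` (for `e ∈ E`)
depends only on the `r`-block at `0`. -/
def LocallyDetermined {G : Type} [Group G] (𝔅 : Set (Config D A))
    (C : (Fin D → ℤ) → Config D A → G) (r : ℕ) : Prop :=
  ∀ e ∈ stdSteps D, ∀ b ∈ 𝔅, ∀ b' ∈ 𝔅,
    blockAt r b 0 = blockAt r b' 0 → C e b = C e b'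

/-- A fundamental cocycle: every continuous cocycle into a discrete group is
cohomologous to a homomorphic image of `Cstar`. -/
def IsFundamental [TopologicalSpace A] {Gs : Type} [Group Gs] [TopologicalSpace Gs] (𝔄 : Set (Config D A))
    (Cstar : (Fin D → ℤ) → Config D A → Gs) : Prop :=
  ∀ (H : Type) [Group H] [TopologicalSpace H] [DiscreteTopology H],
    ∀ C : (Fin D → ℤ) → Config D A → H,
      DynCocycleOn 𝔄 C → ∃ ψ : Gs →* H, DynCohomologous 𝔄 C fun z a => ψ (Cstar z a)


/-! ### Trails and locally determined cocycles via local rules -/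

/-- A trail: a nonempty sequence in `ℤ^D` whose successive steps lie in `E`. -/
def IsTrail (ζ : List (Fin D → ℤ)) : Prop :=
  ζ ≠ [] ∧ ζ.Chain' fun x y => y - x ∈ stdSteps D

/-- The trail `ζ` lies in `Y`. -/
def TrailIn (Y : Set (Fin D → ℤ)) (ζ : List (Fin D → ℤ)) : Prop := ∀ z ∈ ζ, z ∈ Y

/-- A closed trail: the first and last points coincide. -/
def IsClosedTrail (ζ : List (Fin D → ℤ)) : Prop := ζ.head? = ζ.getLast?

/-- Concatenation of trails (the final point of `ζ` should equal the initial
point of `ξ`). -/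
def trailConcat (ζ ξ : List (Fin D → ℤ)) : List (Fin D → ℤ) := ζ ++ ξ.tail

/-- The value `c(ζ, a)` of a local rule along a trail, later steps multiplied
on the left. -/
def trailVal {G : Type} [Group G] {r : ℕ} (c : (Fin D → ℤ) → (ballZ D r → A) → G)
    (a : Config D A) : List (Fin D → ℤ) → G
  | [] => 1
  | [_] => 1
  | x :: y :: rest => trailVal c a (y :: rest) * c (y - x) (blockAt r a x)

/-- A local rule of radius `r` for a `G`-valued cocycle on `𝔄`. -/
def IsLocalRule {G : Type} [Group G] (𝔄 : Set (Config D A)) (r : ℕ)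
    (c : (Fin D → ℤ) → (ballZ D r → A) → G) : Prop :=
  ∀ a : Config D A, ∀ e ∈ stdSteps D, ∀ e' ∈ stdSteps D,
    ((0 ∈ goodSet 𝔄 r a ∧ e ∈ goodSet 𝔄 r a ∧ e' ∈ goodSet 𝔄 r a ∧
        e + e' ∈ goodSet 𝔄 r a) →
      c e' (blockAt r a e) * c e (blockAt r a 0) =
        c e (blockAt r a e') * c e' (blockAt r a 0)) ∧
    ((0 ∈ goodSet 𝔄 r a ∧ e ∈ goodSet 𝔄 r a) →
      c (-e) (blockAt r a e) = (c e (blockAt r a 0))⁻¹)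

/-- Elementary `Y`-homotopies of trails. -/
inductive ElemHomotopy (Y : Set (Fin D → ℤ)) :
    List (Fin D → ℤ) → List (Fin D → ℤ) → Prop
  | slide (pre post : List (Fin D → ℤ)) (x y z : Fin D → ℤ)
      (hxy : y - x ∈ stdSteps D) (hyz : z - y ∈ stdSteps D) (hw : x + z - y ∈ Y) :
      ElemHomotopy Y (pre ++ x :: y :: z :: post) (pre ++ x :: (x + z - y) :: z :: post)
  | delBacktrack (pre post : List (Fin D → ℤ)) (x y : Fin D → ℤ)
      (hstep : y - x ∈ stdSteps D) :
      ElemHomotopy Y (pre ++ x :: y :: x :: post) (pre ++ x :: post)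
  | insBacktrack (pre post : List (Fin D → ℤ)) (x y : Fin D → ℤ)
      (hy : y ∈ Y) (hstep : y - x ∈ stdSteps D) :
      ElemHomotopy Y (pre ++ x :: post) (pre ++ x :: y :: x :: post)

/-- Two trails are `Y`-homotopic if joined by a finite chain of elementary
`Y`-homotopies. -/
def TrailHomotopic (Y : Set (Fin D → ℤ)) : List (Fin D → ℤ) → List (Fin D → ℤ) → Prop :=
  Relation.ReflTransGen fun p q => ElemHomotopy Y p q ∨ ElemHomotopy Y q p

/-- Points `z`, `y` joined by a trail lying in `Y`. -/
def TrailConnIn (Y : Set (Fin D → ℤ)) (z y : Fin D → ℤ) : Prop :=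
  ∃ (ζ : List (Fin D → ℤ)) (h : ζ ≠ []),
    IsTrail ζ ∧ TrailIn Y ζ ∧ ζ.head h = z ∧ ζ.getLast h = y

/-- `a` has a projective `c`-pole: for every `R ≥ r` there is a closed trail in
`G_R(a)` with nontrivial value. -/
def HasProjPole {G : Type} [Group G] (𝔄 : Set (Config D A)) (r : ℕ)
    (c : (Fin D → ℤ) → (ballZ D r → A) → G) (a : Config D A) : Prop :=
  ∀ R : ℕ, r ≤ R → ∃ ζ : List (Fin D → ℤ),
    IsTrail ζ ∧ IsClosedTrail ζ ∧ TrailIn (goodSet 𝔄 R a) ζ ∧ trailVal c a ζ ≠ 1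

/-- Restriction of a `ρ`-block to an `r`-block (`r ≤ ρ`). -/
def restrictBlock {r ρ : ℕ} (h : r ≤ ρ) (p : ballZ D ρ → A) : ballZ D r → A :=
  fun w => p ⟨w.1, by
    intro i
    exact le_trans (w.2 i) (by exact_mod_cast h)⟩

/-- The lift of a local rule of radius `r` to radius `ρ ≥ r`. -/
def liftRule {G : Type} [Group G] {r ρ : ℕ} (h : r ≤ ρ)
    (c : (Fin D → ℤ) → (ballZ D r → A) → G) :
    (Fin D → ℤ) → (ballZ D ρ → A) → G :=
  fun e p => c e (restrictBlock h p)

/-- Local rules of radius `ρ` are locally cohomologous via a local transfer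
function of some radius `s ≤ ρ`. -/
def LocallyCohomologous {G : Type} [Group G] (𝔄 : Set (Config D A)) (ρ : ℕ)
    (c₁ c₂ : (Fin D → ℤ) → (ballZ D ρ → A) → G) : Prop :=
  ∃ (s : ℕ) (_ : s ≤ ρ) (b : (ballZ D s → A) → G),
    ∀ a : Config D A, ∀ e ∈ stdSteps D,
      (0 ∈ goodSet 𝔄 ρ a ∧ e ∈ goodSet 𝔄 ρ a) →
      c₂ e (blockAt ρ a 0) = b (blockAt s a e) * c₁ e (blockAt ρ a 0) *
        (b (blockAt s a 0))⁻¹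

/-- Extend a block to a configuration (arbitrarily outside the block). -/
noncomputable def blockExtend [Nonempty A] {ρ : ℕ} (p : ballZ D ρ → A) : Config D A :=
  fun z => @dite A (z ∈ ballZ D ρ) (Classical.propDecidable _)
    (fun h => p ⟨z, h⟩) (fun _ => Classical.arbitrary A)

/-- The block map `Φ̄ : 𝔄_(r+R) → 𝔄_(r)` induced by a CA `Φ` of radius `R`. -/
noncomputable def blockMapCA [Nonempty A] (Φ : Config D A → Config D A) (R r : ℕ)
    (p : ballZ D (r + R) → A) : ballZ D r → A :=
  blockAt r (Φ (blockExtend p)) 0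

/-- The pullback local rule `Φ_* c` of radius `r + R`. -/
noncomputable def pullRule [Nonempty A] {G : Type} [Group G]
    (Φ : Config D A → Config D A) (R r : ℕ)
    (c : (Fin D → ℤ) → (ballZ D r → A) → G) :
    (Fin D → ℤ) → (ballZ D (r + R) → A) → G :=
  fun e p => c e (blockMapCA Φ R r p)

/-- Two local rules (of radii `r₁`, `r₂`) define the same class in
`H¹_loc(𝔄, G)`. -/
def SameHlocClass {G : Type} [CommGroup G] (𝔄 : Set (Config D A)) {r₁ r₂ : ℕ}
    (c₁ : (Fin D → ℤ) → (ballZ D r₁ → A) → G)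
    (c₂ : (Fin D → ℤ) → (ballZ D r₂ → A) → G) : Prop :=
  ∃ (ρ : ℕ) (h₁ : r₁ ≤ ρ) (h₂ : r₂ ≤ ρ) (h : (Fin D → ℤ) → G),
    (∀ y z : Fin D → ℤ, h (y + z) = h y * h z) ∧
    LocallyCohomologous 𝔄 ρ (liftRule h₁ c₁) fun e p => liftRule h₂ c₂ e p * h e

/-- `a` has a projective `G`-pole: a projective `c`-pole for some `G`-valued
local rule `c` of some radius. -/
def HasProjGPole (G : Type) [Group G] (𝔄 : Set (Config D A)) (a : Config D A) : Prop :=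
  ∃ (r : ℕ) (c : (Fin D → ℤ) → (ballZ D r → A) → G),
    IsLocalRule 𝔄 r c ∧ HasProjPole 𝔄 r c a

/-- A locally fundamental local rule (valued in a discrete abelian group). -/
def IsLocallyFundamental {Gs : Type} [CommGroup Gs] (𝔄 : Set (Config D A)) (rstar : ℕ)
    (cstar : (Fin D → ℤ) → (ballZ D rstar → A) → Gs) : Prop :=
  ∀ (H : Type) [CommGroup H], ∀ (r : ℕ) (c : (Fin D → ℤ) → (ballZ D r → A) → H),
    IsLocalRule 𝔄 r c →
    ∃ (ψ : Gs →* H) (ρ : ℕ) (h₁ : rstar ≤ ρ) (h₂ : r ≤ ρ),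
      LocallyCohomologous 𝔄 ρ (liftRule h₁ fun e p => ψ (cstar e p)) (liftRule h₂ c)

/-- A pseudonorm on `G`, with values in `[0, ∞]`. -/
def IsPseudonorm {G : Type} [Group G] (ν : G → ℝ≥0∞) : Prop :=
  ν 1 = 0 ∧ (∀ g h : G, ν (g * h) = ν (h * g)) ∧ ∀ g h : G, ν (g * h) ≤ ν g + ν h

/-- The `ℓ¹`-norm on `ℤ^D`. -/
def l1norm {D : ℕ} (v : Fin D → ℤ) : ℕ := ∑ i, (v i).natAbs


/-! ### Additive dynamical and equivariant cocycles -/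

/-- A continuous `(G,+)`-valued dynamical cocycle on `𝔄`. -/
def AddDynCocycleOn [TopologicalSpace A] {G : Type} [AddCommGroup G] [TopologicalSpace G]
    (𝔄 : Set (Config D A)) (C : (Fin D → ℤ) → Config D A → G) : Prop :=
  (∀ z : Fin D → ℤ, ContinuousOn (C z) 𝔄) ∧
    ∀ y z : Fin D → ℤ, ∀ a ∈ 𝔄, C (y + z) a = C y (shift z a) + C z a

/-- Cohomologous additive cocycles. -/
def AddDynCohomologous [TopologicalSpace A] {G : Type} [AddCommGroup G] [TopologicalSpace G]
    (𝔄 : Set (Config D A)) (C C' : (Fin D → ℤ) → Config D A → G) : Prop :=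
  ∃ b : Config D A → G, ContinuousOn b 𝔄 ∧
    ∀ z : Fin D → ℤ, ∀ a ∈ 𝔄, C' z a = b (shift z a) + C z a - b a

/-- The equivariant edge cocycle `Ψ(C̃)(x→y; a) = C̃(y−x, σ^x(a))` associated to a
dynamical cocycle. -/
def edgeCocycleOf {G : Type} [AddCommGroup G] (C : (Fin D → ℤ) → Config D A → G) :
    (Fin D → ℤ) → (Fin D → ℤ) → Config D A → G :=
  fun x y a => C (y - x) (shift x a)

/-- A continuous equivariant 1-cocycle on `𝔄` (as a function of oriented edges
`x → y`, i.e. pairs with `y - x ∈ E`). -/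
def IsEqCocycle [TopologicalSpace A] {G : Type} [AddCommGroup G] [TopologicalSpace G]
    (𝔄 : Set (Config D A)) (C : (Fin D → ℤ) → (Fin D → ℤ) → Config D A → G) : Prop :=
  (∀ x y : Fin D → ℤ, y - x ∈ stdSteps D → ContinuousOn (C x y) 𝔄) ∧
  (∀ x y z : Fin D → ℤ, y - x ∈ stdSteps D → ∀ a ∈ 𝔄,
      C x y (shift z a) = C (x + z) (y + z) a) ∧
  (∀ x y : Fin D → ℤ, y - x ∈ stdSteps D → ∀ a ∈ 𝔄, C y x a = -C x y a) ∧
  (∀ s : Fin D → ℤ, ∀ i j : Fin D, i ≠ j → ∀ a ∈ 𝔄,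
      C s (s + Pi.single i 1) a +
        C (s + Pi.single i 1) (s + Pi.single i 1 + Pi.single j 1) a =
      C s (s + Pi.single j 1) a +
        C (s + Pi.single j 1) (s + Pi.single i 1 + Pi.single j 1) a)

/-- Cohomologous equivariant 1-cocycles, via an equivariant continuous
0-cochain `B`. -/
def EqCohomologous [TopologicalSpace A] {G : Type} [AddCommGroup G] [TopologicalSpace G]
    (𝔄 : Set (Config D A)) (C C' : (Fin D → ℤ) → (Fin D → ℤ) → Config D A → G) : Prop :=
  ∃ B : (Fin D → ℤ) → Config D A → G,
    (∀ x : Fin D → ℤ, ContinuousOn (B x) 𝔄) ∧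
    (∀ x z : Fin D → ℤ, ∀ a ∈ 𝔄, B x (shift z a) = B (x + z) a) ∧
    ∀ x y : Fin D → ℤ, y - x ∈ stdSteps D → ∀ a ∈ 𝔄,
      C' x y a = B y a + C x y a - B x a

/-! ### Cells, chains, and equivariant `d`-cocycles -/

/-- A cell in `ℤ^D`: a base point together with a set of spanning directions. -/
abbrev Cell (D : ℕ) := (Fin D → ℤ) × Finset (Fin D)

/-- Chains: finitely supported `ℤ`-valued functions on cells. -/
abbrev CellChain (D : ℕ) := Cell D →₀ ℤ

/-- The boundary of a single cell. -/
noncomputable def cellBoundary {D : ℕ} (cell : Cell D) : CellChain D :=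
  ∑ i ∈ cell.2, ((-1 : ℤ) ^ (cell.2.filter fun j => j < i).card) •
    (Finsupp.single (cell.1 + Pi.single i 1, cell.2.erase i) (1 : ℤ) -
      Finsupp.single (cell.1, cell.2.erase i) (1 : ℤ))

/-- The boundary homomorphism on chains. -/
noncomputable def chainBoundary {D : ℕ} (ζ : CellChain D) : CellChain D :=
  ζ.sum fun cell n => n • cellBoundary cell

/-- The value of an equivariant cochain (of radius `r`) on a chain. -/
def chainVal {G : Type} [AddCommGroup G] {r : ℕ}
    (c : Finset (Fin D) → (ballZ D r → A) → G) (a : Config D A) (ζ : CellChain D) : G :=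
  ζ.sum fun cell n => n • c cell.2 (blockAt r a cell.1)

/-- An equivariant `d`-cocycle of radius `r` on `𝔄`: vanishes on boundaries of
`(d+1)`-cells over admissible configurations. -/
def IsEqDCocycle {G : Type} [AddCommGroup G] (𝔄 : Set (Config D A)) (d r : ℕ)
    (c : Finset (Fin D) → (ballZ D r → A) → G) : Prop :=
  ∀ a ∈ 𝔄, ∀ cell : Cell D, cell.2.card = d + 1 →
    chainVal c a (cellBoundary cell) = 0

/-- `a` has a projective `(G,d)`-pole. -/
def HasProjDPole (G : Type) [AddCommGroup G] (𝔄 : Set (Config D A)) (d : ℕ)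
    (a : Config D A) : Prop :=
  ∃ (r : ℕ) (c : Finset (Fin D) → (ballZ D r → A) → G),
    IsEqDCocycle 𝔄 d r c ∧
    ∀ R : ℕ, r ≤ R → ∃ ζ : CellChain D,
      (∀ cell ∈ ζ.support, (cell : Cell D).2.card = d) ∧
      chainBoundary ζ = 0 ∧
      (∀ cell ∈ ζ.support, (cell : Cell D).1 ∈ goodSet 𝔄 R a) ∧
      chainVal c a ζ ≠ 0


/-! ### Admissibility of blocks -/

lemma blockAt_shift (r : ℕ) (a : Config D A) (x z : Fin D → ℤ) :
    blockAt r (shift x a) z = blockAt r a (z + x) := by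
  funext w
  simp only [blockAt, shift]
  congr 1
  abel

lemma IsSubshift.shift_mem [TopologicalSpace A] {𝔄 : Set (Config D A)} (h : IsSubshift 𝔄)
    (v : Fin D → ℤ) {b : Config D A} (hb : b ∈ 𝔄) : shift v b ∈ 𝔄 := by
  rw [← h.2.2 v]
  exact ⟨b, hb, rfl⟩

lemma IsSubshift.mem_goodSet [TopologicalSpace A] {𝔄 : Set (Config D A)} (h : IsSubshift 𝔄)
    (r : ℕ) {b : Config D A} (hb : b ∈ 𝔄) (z : Fin D → ℤ) : z ∈ goodSet 𝔄 r b :=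
  ⟨shift z b, h.shift_mem z hb, by simp [blockAt_shift]⟩

lemma IsSubshift.add_mem_goodSet [TopologicalSpace A] {𝔄 : Set (Config D A)}
    (h : IsSubshift 𝔄) {R s : ℕ} {a : Config D A} {z w : Fin D → ℤ}
    (hz : z ∈ goodSet 𝔄 (R + s) a) (hw : w ∈ ballZ D s) : z + w ∈ goodSet 𝔄 R a := by
  obtain ⟨b, hb, hba⟩ := hz
  refine ⟨shift w b, h.shift_mem w hb, ?_⟩
  funext u
  have hu : u.1 + w ∈ ballZ D (R + s) := fun i => by
    have h1 := u.2 i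
    have h2 := hw i
    have h3 := abs_add_le (u.1 i) (w i)
    simp only [Pi.add_apply]
    push_cast
    linarith
  have := congrFun hba ⟨_, hu⟩
  simp only [blockAt, shift, zero_add] at this ⊢
  rw [this]
  congr 1
  abel

lemma IsSubshift.goodSet_anti [TopologicalSpace A] {𝔄 : Set (Config D A)}
    (h : IsSubshift 𝔄) {R R' : ℕ} (hR : R ≤ R') (a : Config D A) :
    goodSet 𝔄 R' a ⊆ goodSet 𝔄 R a := by
  intro z hz
  obtain ⟨s, rfl⟩ := Nat.exists_eq_add_of_le hR
  have h0 : (0 : Fin D → ℤ) ∈ ballZ D s := fun i => by simp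
  simpa using h.add_mem_goodSet hz h0

/-! ### The `ℓ¹`-norm -/

lemma l1norm_neg (v : Fin D → ℤ) : l1norm (-v) = l1norm v := by
  simp [l1norm]

lemma l1norm_add_le (v w : Fin D → ℤ) : l1norm (v + w) ≤ l1norm v + l1norm w := by
  simp only [l1norm, ← Finset.sum_add_distrib]
  exact Finset.sum_le_sum fun i _ => Int.natAbs_add_le _ _

lemma l1norm_eq_zero {v : Fin D → ℤ} : l1norm v = 0 ↔ v = 0 := by
  simp [l1norm, funext_iff]

lemma neg_mem_stdSteps {e : Fin D → ℤ} (he : e ∈ stdSteps D) : -e ∈ stdSteps D := by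
  obtain ⟨i, rfl | rfl⟩ := he
  · exact ⟨i, Or.inr rfl⟩
  · exact ⟨i, Or.inl (neg_neg _)⟩

lemma l1norm_stdStep {e : Fin D → ℤ} (he : e ∈ stdSteps D) : l1norm e = 1 := by
  have key (i : Fin D) : l1norm (Pi.single i 1 : Fin D → ℤ) = 1 := by
    rw [l1norm, Finset.sum_eq_single i] <;> simp +contextual
  obtain ⟨i, rfl | rfl⟩ := he
  · exact key i
  · rw [l1norm_neg, key i]

lemma exists_stdStep_l1norm_sub {v : Fin D → ℤ} (hv : v ≠ 0) :
    ∃ e ∈ stdSteps D, l1norm v = l1norm (v - e) + 1 := by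
  obtain ⟨i, hi⟩ := Function.ne_iff.mp hv
  have key (e : Fin D → ℤ) (he : ∀ j, j ≠ i → e j = 0)
      (h : (v i).natAbs = (v i - e i).natAbs + 1) : l1norm v = l1norm (v - e) + 1 := by
    simp only [l1norm]
    rw [← Finset.add_sum_erase _ _ (Finset.mem_univ i),
      ← Finset.add_sum_erase (a := i) _ (fun j => ((v - e) j).natAbs) (Finset.mem_univ i),
      Finset.sum_congr (g := fun j => ((v - e) j).natAbs) rfl fun j hj => by
        simp [he j (Finset.ne_of_mem_erase hj)]]
    simp only [Pi.sub_apply]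
    omega
  simp only [Pi.zero_apply] at hi
  rcases lt_or_gt_of_ne hi with h | h
  · refine ⟨-Pi.single i 1, ⟨i, Or.inr rfl⟩, key _ (fun j hj => by simp [hj]) ?_⟩
    simp only [Pi.neg_apply, Pi.single_eq_same]
    omega
  · refine ⟨Pi.single i 1, ⟨i, Or.inl rfl⟩, key _ (fun j hj => by simp [hj]) ?_⟩
    simp only [Pi.single_eq_same]
    omega

/-- Induction along geodesics of `ℤ^D`. -/
lemma stdSteps_induction {P : (Fin D → ℤ) → Prop} (zero : P 0)
    (step : ∀ v, ∀ e ∈ stdSteps D, l1norm (v + e) = l1norm v + 1 → P v → P (v + e))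
    (v : Fin D → ℤ) : P v := by
  induction h : l1norm v generalizing v with
  | zero => rwa [l1norm_eq_zero.mp h]
  | succ n ih =>
    have hv : v ≠ 0 := by
      rintro rfl
      rw [l1norm_eq_zero.mpr rfl] at h
      omega
    obtain ⟨e, he, hl⟩ := exists_stdStep_l1norm_sub hv
    have := step (v - e) e he (by simpa using hl) (ih _ (by omega))
    simpa using this

/-! ### Cocycles on `ℤ^D` are coboundaries -/

/-- The action of the `i`-th generator of `ℤ^D` on `ℤ^D × G` given by parallel transport. -/
def transport {G : Type} [Group G] (φ : (Fin D → ℤ) → (Fin D → ℤ) → G) (i : Fin D) :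
    Equiv.Perm ((Fin D → ℤ) × G) where
  toFun p := (p.1 + Pi.single i 1, φ p.1 (Pi.single i 1) * p.2)
  invFun p := (p.1 - Pi.single i 1, (φ (p.1 - Pi.single i 1) (Pi.single i 1))⁻¹ * p.2)
  left_inv p := by simp
  right_inv p := by simp

lemma exists_potential {G : Type} [Group G] (φ : (Fin D → ℤ) → (Fin D → ℤ) → G)
    (hcomm : ∀ x, ∀ e ∈ stdSteps D, ∀ e' ∈ stdSteps D,
      φ (x + e) e' * φ x e = φ (x + e') e * φ x e')
    (hinv : ∀ x, ∀ e ∈ stdSteps D, φ (x + e) (-e) = (φ x e)⁻¹) :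
    ∃ F : (Fin D → ℤ) → G, ∀ x, ∀ e ∈ stdSteps D, φ x e = F (x + e) * (F x)⁻¹ := by
  have hT : Pairwise fun i j => ∀ m n : Multiplicative ℤ,
      Commute (zpowersHom _ (transport φ i) m) (zpowersHom _ (transport φ j) n) := by
    intro i j _ m n
    have : Commute (transport φ i) (transport φ j) := by
      refine Equiv.ext fun p => Prod.ext ?_ ?_
      · simp only [Equiv.Perm.mul_apply, transport, Equiv.coe_fn_mk]
        abel
      · simp only [Equiv.Perm.mul_apply, transport, Equiv.coe_fn_mk, ← mul_assoc]
        rw [hcomm _ _ ⟨j, Or.inl rfl⟩ _ ⟨i, Or.inl rfl⟩]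
    simpa [zpowersHom_apply] using this.zpow_zpow _ _
  let H := MonoidHom.noncommPiCoprod (fun i => zpowersHom _ (transport φ i)) hT
  let P : (Fin D → ℤ) → (Fin D → ℤ) × G := fun v => H (fun i => Multiplicative.ofAdd (v i)) (0, 1)
  have hP (v : Fin D → ℤ) (i : Fin D) : P (v + Pi.single i 1) = transport φ i (P v) := by
    have h1 : (fun k => Multiplicative.ofAdd ((v + Pi.single i 1 : Fin D → ℤ) k)) =
        (Pi.mulSingle i (Multiplicative.ofAdd 1) : Fin D → Multiplicative ℤ) *
          fun k => Multiplicative.ofAdd (v k) := by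
      funext k
      by_cases hk : k = i
      · subst hk
        simp [mul_comm]
      · simp [hk]
    have h2 : H (Pi.mulSingle i (Multiplicative.ofAdd 1)) = transport φ i := by
      rw [MonoidHom.noncommPiCoprod_mulSingle]
      simp
    change H _ _ = _
    rw [h1, map_mul, h2, Equiv.Perm.mul_apply]
  have hfst (v : Fin D → ℤ) : (P v).1 = v := by
    induction v using stdSteps_induction with
    | zero =>
      have : (fun i => Multiplicative.ofAdd ((0 : Fin D → ℤ) i)) = 1 := rfl
      change (H _ _).1 = 0
      rw [this, map_one, Equiv.Perm.one_apply]
    | step v e he _ ih =>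
      obtain ⟨i, rfl | rfl⟩ := he
      · simp [hP, transport, ih]
      · have := hP (v + -Pi.single i 1) i
        rw [neg_add_cancel_right] at this
        rw [this] at ih
        simp only [transport, Equiv.coe_fn_mk] at ih
        exact eq_add_neg_of_add_eq ih
  have hpos (x : Fin D → ℤ) (i : Fin D) :
      φ x (Pi.single i 1) = (P (x + Pi.single i 1)).2 * (P x).2⁻¹ := by
    simp [hP, transport, hfst]
  refine ⟨fun v => (P v).2, fun x e he => ?_⟩
  obtain ⟨i, rfl | rfl⟩ := he
  · exact hpos x i
  · have h1 := hinv (x + -Pi.single i 1) (Pi.single i 1) ⟨i, Or.inl rfl⟩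
    have h2 := hpos (x + -Pi.single i 1) i
    rw [neg_add_cancel_right] at h1 h2
    rw [h1, h2]
    simp

/-! ### Trails as walks -/

/-- `Walk Y φ x y g n`: some trail of length `n` in `Y` leads from `x` to `y`, and its value with
respect to the edge weights `φ` is `g`. -/
inductive Walk {G : Type} [Group G] (Y : Set (Fin D → ℤ)) (φ : (Fin D → ℤ) → (Fin D → ℤ) → G) :
    (Fin D → ℤ) → (Fin D → ℤ) → G → ℕ → Prop
  | refl (x : Fin D → ℤ) (hx : x ∈ Y) : Walk Y φ x x 1 0
  | cons (x y z : Fin D → ℤ) (g : G) (n : ℕ) (hx : x ∈ Y) (hxy : y - x ∈ stdSteps D)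
      (h : Walk Y φ y z g n) : Walk Y φ x z (g * φ x (y - x)) (n + 1)

namespace Walk

variable {G : Type} [Group G] {Y : Set (Fin D → ℤ)} {φ : (Fin D → ℤ) → (Fin D → ℤ) → G}
  {x y z : Fin D → ℤ} {g h : G} {m n : ℕ}

lemma left_mem (w : Walk Y φ x y g n) : x ∈ Y := by
  cases w <;> assumption

lemma trans (w : Walk Y φ x y g n) (w' : Walk Y φ y z h m) :
    ∃ k, Walk Y φ x z (h * g) k := by
  induction w with
  | refl x hx => exact ⟨m, by simpa using w'⟩
  | cons x u y g n hx hxu _ ih =>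
    obtain ⟨k, hk⟩ := ih w'
    exact ⟨k + 1, by simpa [mul_assoc] using cons x u z _ k hx hxu hk⟩

lemma symm (w : Walk Y φ x y g n) : ∃ h k, Walk Y φ y x h k := by
  induction w with
  | refl x hx => exact ⟨1, 0, refl x hx⟩
  | cons x u y g n hx hxu w ih =>
    obtain ⟨h, k, hk⟩ := ih
    have hux : x - u ∈ stdSteps D := by simpa using neg_mem_stdSteps hxu
    obtain ⟨k', hk'⟩ := hk.trans (cons u x x 1 0 w.left_mem hux (refl x hx))
    exact ⟨_, _, hk'⟩

lemma congr {Y' : Set (Fin D → ℤ)} {φ' : (Fin D → ℤ) → (Fin D → ℤ) → G} (hY : Y ⊆ Y')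
    (hφ : ∀ x ∈ Y, ∀ e, φ x e = φ' x e) (w : Walk Y φ x y g n) : Walk Y' φ' x y g n := by
  induction w with
  | refl x hx => exact refl x (hY hx)
  | cons x u y g n hx hxu _ ih =>
    rw [hφ x hx]
    exact cons x u y g n (hY hx) hxu ih

lemma eq_of_potential {F : (Fin D → ℤ) → G}
    (hF : ∀ x, ∀ e ∈ stdSteps D, φ x e = F (x + e) * (F x)⁻¹) (w : Walk Y φ x y g n) :
    g = F y * (F x)⁻¹ := by
  induction w with
  | refl x hx => simp
  | cons x u y g n hx hxu _ ih =>
    rw [ih, hF x _ hxu]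
    simp

lemma pseudonorm_le {ν : G → ℝ≥0∞} (hν : IsPseudonorm ν)
    (hφ : ∀ x ∈ Y, ∀ e ∈ stdSteps D, ν (φ x e) ≤ 1) (w : Walk Y φ x y g n) : ν g ≤ n := by
  induction w with
  | refl x hx => simp [hν.1]
  | cons x u y g n hx hxu _ ih =>
    push_cast
    exact (hν.2.2 _ _).trans (add_le_add ih (hφ x hx _ hxu))

lemma l1norm_sub_le (w : Walk Y φ x y g n) : l1norm (y - x) ≤ n := by
  induction w with
  | refl x hx => simp [l1norm]
  | cons x u y g n hx hxu _ ih =>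
    have := l1norm_add_le (y - u) (u - x)
    rw [sub_add_sub_cancel, l1norm_stdStep hxu] at this
    omega

variable {r : ℕ} {c : (Fin D → ℤ) → (ballZ D r → A) → G} {a : Config D A}

lemma exists_trail (w : Walk Y (fun x e => c e (blockAt r a x)) x y g n) :
    ∃ (ζ : List (Fin D → ℤ)) (h : ζ ≠ []), IsTrail ζ ∧ TrailIn Y ζ ∧ ζ.head h = x ∧
      ζ.getLast h = y ∧ trailVal c a ζ = g := by
  induction w with
  | refl x hx =>
    exact ⟨[x], by simp, ⟨by simp, List.isChain_singleton _⟩, by simpa [TrailIn] using hx, rfl, rfl, rfl⟩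
  | cons x u y g n hx hxu _ ih =>
    obtain ⟨ζ, h, ⟨_, hc⟩, hY, hh, hl, hv⟩ := ih
    obtain ⟨v, ζ, rfl⟩ := List.exists_cons_of_ne_nil h
    obtain rfl : v = u := hh
    refine ⟨x :: v :: ζ, by simp, ⟨by simp, List.isChain_cons_cons.mpr ⟨hxu, hc⟩⟩, ?_, rfl,
      by simpa using hl, by simp [trailVal, hv]⟩
    intro z hz
    rcases List.mem_cons.mp hz with rfl | hz
    · exact hx
    · exact hY z hz

lemma of_trail {ζ : List (Fin D → ℤ)} (h : ζ ≠ []) (ht : IsTrail ζ) (hY : TrailIn Y ζ) :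
    Walk Y (fun x e => c e (blockAt r a x)) (ζ.head h) (ζ.getLast h) (trailVal c a ζ)
      (ζ.length - 1) := by
  induction ζ with
  | nil => exact absurd rfl h
  | cons x ζ ih =>
    cases ζ with
    | nil => exact refl x (hY x (by simp))
    | cons u ζ =>
      obtain ⟨hxu, hc⟩ := List.isChain_cons_cons.mp ht.2
      exact cons x u _ _ _ (hY x (by simp)) hxu
        (ih (by simp) ⟨by simp, hc⟩ fun z hz => hY z (List.mem_cons_of_mem _ hz))

lemma _root_.Defects.TrailConnIn.exists_walk (h : TrailConnIn Y x y) :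
    ∃ g n, Walk Y (fun x e => c e (blockAt r a x)) x y g n := by
  obtain ⟨ζ, h, ht, hY, rfl, rfl⟩ := h
  exact ⟨_, _, of_trail h ht hY⟩

lemma trailConnIn (w : Walk Y (fun x e => c e (blockAt r a x)) x y g n) : TrailConnIn Y x y := by
  obtain ⟨ζ, h, ht, hY, hh, hl, _⟩ := w.exists_trail
  exact ⟨ζ, h, ht, hY, hh, hl⟩

end Walk

lemma potential_pseudonorm_le {G : Type} [Group G] {ν : G → ℝ≥0∞} (hν : IsPseudonorm ν)
    {F : (Fin D → ℤ) → G} (hF : ∀ x, ∀ e ∈ stdSteps D, ν (F (x + e) * (F x)⁻¹) ≤ 1)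
    (x y : Fin D → ℤ) : ν (F y * (F x)⁻¹) ≤ l1norm (y - x) := by
  have key (v : Fin D → ℤ) : ν (F (x + v) * (F x)⁻¹) ≤ l1norm v := by
    induction v using stdSteps_induction with
    | zero => simp [hν.1]
    | step v e he hl ih =>
      have h := hν.2.2 (F (x + v + e) * (F (x + v))⁻¹) (F (x + v) * (F x)⁻¹)
      rw [mul_assoc, inv_mul_cancel_left, add_assoc] at h
      rw [hl]
      rw [Nat.cast_succ, add_comm (l1norm v : ℝ≥0∞)]
      exact h.trans (add_le_add (by simpa [add_assoc] using hF (x + v) e he) ih)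
  simpa using key (y - x)

lemma IsLocalRule.exists_potential [TopologicalSpace A] {𝔄 : Set (Config D A)}
    (h𝔄 : IsSubshift 𝔄) {G : Type} [Group G] {r : ℕ} {c : (Fin D → ℤ) → (ballZ D r → A) → G}
    (hc : IsLocalRule 𝔄 r c) {b : Config D A} (hb : b ∈ 𝔄) :
    ∃ F : (Fin D → ℤ) → G, ∀ x, ∀ e ∈ stdSteps D,
      c e (blockAt r b x) = F (x + e) * (F x)⁻¹ := by
  have hg (x z : Fin D → ℤ) : z ∈ goodSet 𝔄 r (shift x b) :=
    h𝔄.mem_goodSet r (h𝔄.shift_mem x hb) z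
  refine Defects.exists_potential (fun x e => c e (blockAt r b x)) ?_ ?_
  · intro x e he e' he'
    have := (hc (shift x b) e he e' he').1 ⟨hg _ _, hg _ _, hg _ _, hg _ _⟩
    simpa [blockAt_shift, add_comm] using this
  · intro x e he
    have := (hc (shift x b) e he e he).2 ⟨hg _ _, hg _ _⟩
    simpa [blockAt_shift, add_comm] using this

lemma IsPseudonorm.conj {G : Type} [Group G] {ν : G → ℝ≥0∞} (hν : IsPseudonorm ν) (g h : G) :
    ν (h * g * h⁻¹) = ν g := by
  rw [hν.2.1]
  simp

lemma IsPseudonorm.mul_inv_le {G : Type} [Group G] {ν : G → ℝ≥0∞} (hν : IsPseudonorm ν)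
    (p q s t u v : G) :
    ν (p * s⁻¹ * u * (q * t⁻¹ * v)⁻¹) ≤ ν (s⁻¹ * u * v⁻¹ * t) + ν (p * q⁻¹) := by
  have : p * s⁻¹ * u * (q * t⁻¹ * v)⁻¹ = p * (s⁻¹ * u * v⁻¹ * t) * p⁻¹ * (p * q⁻¹) := by
    group
  rw [this, ← hν.conj (s⁻¹ * u * v⁻¹ * t) p]
  exact hν.2.2 _ _

theorem statement_15 {D : ℕ} (hD : 1 ≤ D) {A : Type} [Fintype A] [Nonempty A]
    [TopologicalSpace A] [DiscreteTopology A]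
    (𝔄 : Set (Config D A)) (h𝔄 : IsSubshift 𝔄)
    {G : Type} [Group G] (ν : G → ℝ≥0∞) (hν : IsPseudonorm ν)
    (hfin : ∀ g : G, ν g ≠ ⊤) (hsymm : ∀ g : G, ν g⁻¹ = ν g)
    (r : ℕ) (c : (Fin D → ℤ) → (ballZ D r → A) → G) (hc : IsLocalRule 𝔄 r c)
    (hbound : ∀ e ∈ stdSteps D, ∀ p ∈ admissibleBlocks 𝔄 r, ν (c e p) ≤ 1)
    (a : Config D A) (ha : a ∈ almostAdmissible 𝔄)
    -- path-independence: `grad y z` is the common value of `c(·, a)` on any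
    -- trail from `z` to `y` lying in `G_r(a)`
    (grad : (Fin D → ℤ) → (Fin D → ℤ) → G)
    (hgrad : ∀ (y z : Fin D → ℤ) (ζ : List (Fin D → ℤ)) (h : ζ ≠ []),
        IsTrail ζ → TrailIn (goodSet 𝔄 r a) ζ → ζ.head h = z → ζ.getLast h = y →
        grad y z = trailVal c a ζ)
    -- sharpness
    (hsharp : ∀ R : ℕ, r ≤ R → ∃ K : ℕ, ∀ y ∈ goodSet 𝔄 r a,
        ∃ (ζ : List (Fin D → ℤ)) (h : ζ ≠ []), IsTrail ζ ∧
          TrailIn (goodSet 𝔄 r a) ζ ∧ ζ.head h = y ∧ ζ.length ≤ K + 1 ∧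
          ζ.getLast h ∈ goodSet 𝔄 R a)
    -- no ramification
    (hnoram : ∀ R' : ℕ, r ≤ R' → ∃ R : ℕ, R' ≤ R ∧
        ∀ y z : Fin D → ℤ, y ∈ goodSet 𝔄 R a → z ∈ goodSet 𝔄 R a →
          TrailConnIn (goodSet 𝔄 r a) y z → TrailConnIn (goodSet 𝔄 R' a) y z)
    -- two distinct projective trail-components, with reference points
    (xstar ystar : Fin D → ℤ)
    (hx : xstar ∈ goodSet 𝔄 r a) (hy : ystar ∈ goodSet 𝔄 r a)
    (hsep : ¬ TrailConnIn (goodSet 𝔄 r a) xstar ystar)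
    (hXproj : ∀ R : ℕ, r ≤ R →
        ∃ x, TrailConnIn (goodSet 𝔄 r a) xstar x ∧ x ∈ goodSet 𝔄 R a)
    (hYproj : ∀ R : ℕ, r ≤ R →
        ∃ y, TrailConnIn (goodSet 𝔄 r a) ystar y ∧ y ∈ goodSet 𝔄 R a)
    -- the boundary between the two components is a gap
    (hgap : (⨆ (x : Fin D → ℤ) (_ : TrailConnIn (goodSet 𝔄 r a) xstar x)
          (y : Fin D → ℤ) (_ : TrailConnIn (goodSet 𝔄 r a) ystar y),
        ν (grad x xstar * (grad y ystar)⁻¹) / ((l1norm (x - y) : ℕ) : ℝ≥0∞)) = ⊤) :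
    ¬ Removable 𝔄 a := by
  rintro ⟨r', a', ha', hagree⟩
  set Y := goodSet 𝔄 r a
  set φ : (Fin D → ℤ) → (Fin D → ℤ) → G := fun x e => c e (blockAt r a x)
  have hgW {x y g n} (w : Walk Y φ x y g n) : grad y x = g := by
    obtain ⟨ζ, h, ht, hζ, hh, hl, hv⟩ := w.exists_trail
    rw [hgrad y x ζ h ht hζ hh hl, hv]
  have hφν : ∀ x ∈ Y, ∀ e ∈ stdSteps D, ν (φ x e) ≤ 1 := fun x hx e he => hbound e he _ hx
  obtain ⟨F, hF⟩ := hc.exists_potential h𝔄 ha'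
  have hFν (x y : Fin D → ℤ) : ν (F y * (F x)⁻¹) ≤ l1norm (y - x) := by
    refine potential_pseudonorm_le hν (fun x e he => ?_) x y
    rw [← hF x e he]
    exact hbound e he _ (h𝔄.mem_goodSet r ha' x)
  obtain ⟨R, hR, hram⟩ := hnoram (max r r' + r) (by omega)
  have hblock : ∀ x ∈ goodSet 𝔄 (max r r' + r) a, blockAt r a x = blockAt r a' x := by
    intro x hx
    funext w
    exact (hagree _ (h𝔄.goodSet_anti (le_max_right r r') a (h𝔄.add_mem_goodSet hx w.2))).symm
  have hdeep {x y g n} (w : Walk Y φ x y g n) (hx : x ∈ goodSet 𝔄 R a)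
      (hy : y ∈ goodSet 𝔄 R a) : g = F y * (F x)⁻¹ := by
    obtain ⟨h, k, w'⟩ := (hram x y hx hy w.trailConnIn).exists_walk (c := c) (a := a)
    rw [← hgW w, hgW (w'.congr (h𝔄.goodSet_anti (by omega) a) fun _ _ _ => rfl)]
    exact (w'.congr (φ' := fun x e => c e (blockAt r a' x)) subset_rfl
      fun x hx e => by rw [hblock x hx]).eq_of_potential hF
  obtain ⟨K, hK⟩ := hsharp R (by omega)
  have hretract {s s₀ x : Fin D → ℤ} (h₀ : TrailConnIn Y s s₀) (hs₀ : s₀ ∈ goodSet 𝔄 R a)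
      (hx : TrailConnIn Y s x) : ∃ x₁, l1norm (x₁ - x) ≤ K ∧ ∃ k, ν k ≤ K ∧
        grad x s = k * (F x₁ * (F s₀)⁻¹ * grad s₀ s) := by
    obtain ⟨g₀, n₀, w₀⟩ := h₀.exists_walk (c := c) (a := a)
    obtain ⟨g, n, w⟩ := hx.exists_walk (c := c) (a := a)
    obtain ⟨_, _, w₀'⟩ := w₀.symm
    obtain ⟨_, _, wr⟩ := w.symm
    obtain ⟨ζ, hne, ht, hζ, hh, hlen, hlast⟩ := hK x wr.left_mem
    have wζ : Walk Y φ _ _ _ _ := Walk.of_trail (c := c) (a := a) hne ht hζ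
    rw [hh] at wζ
    have hle : ((ζ.length - 1 : ℕ) : ℝ≥0∞) ≤ K := by
      exact_mod_cast Nat.sub_le_of_le_add hlen
    obtain ⟨_, w₁⟩ := w₀'.trans w
    obtain ⟨_, w₂⟩ := w₁.trans wζ
    obtain ⟨_, w₃⟩ := w.trans wζ
    obtain ⟨_, w₄⟩ := w₀.trans w₂
    refine ⟨_, wζ.l1norm_sub_le.trans (Nat.sub_le_of_le_add hlen), (trailVal c a ζ)⁻¹, ?_, ?_⟩
    · rw [hsymm]
      exact (wζ.pseudonorm_le hν hφν).trans hle
    · rw [← hdeep w₂ hs₀ hlast, hgW w₀, ← hgW w₄, hgW w₃, hgW w, inv_mul_cancel_left]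
  obtain ⟨x₀, hx₀, hx₀R⟩ := hXproj R (by omega)
  obtain ⟨y₀, hy₀, hy₀R⟩ := hYproj R (by omega)
  set M := ν ((F x₀)⁻¹ * grad x₀ xstar * (grad y₀ ystar)⁻¹ * F y₀)
  have hfinal : (4 * K + M + 1 : ℝ≥0∞) ≠ ⊤ := by
    have := hfin ((F x₀)⁻¹ * grad x₀ xstar * (grad y₀ ystar)⁻¹ * F y₀)
    finiteness
  refine hfinal (top_le_iff.mp ?_)
  rw [← hgap]
  refine iSup₂_le fun x hxX => iSup₂_le fun y hyY => ?_
  obtain ⟨x₁, hx₁, k, hk, hgx⟩ := hretract hx₀ hx₀R hxX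
  obtain ⟨y₁, hy₁, l, hl, hgy⟩ := hretract hy₀ hy₀R hyY
  have hxy : x - y ≠ 0 := by
    intro h
    obtain rfl := sub_eq_zero.mp h
    obtain ⟨_, _, w⟩ := hxX.exists_walk (c := c) (a := a)
    obtain ⟨_, _, w'⟩ := hyY.exists_walk (c := c) (a := a)
    obtain ⟨_, _, w''⟩ := w'.symm
    obtain ⟨_, w₃⟩ := w.trans w''
    exact hsep w₃.trailConnIn
  have hpos : 1 ≤ l1norm (x - y) := Nat.one_le_iff_ne_zero.mpr (mt l1norm_eq_zero.mp hxy)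
  have hdist : l1norm (x₁ - y₁) ≤ l1norm (x - y) + 2 * K := by
    have h1 := l1norm_add_le (x₁ - x) (x - y₁)
    have h2 := l1norm_add_le (x - y) (y - y₁)
    have h3 := l1norm_neg (y₁ - y)
    rw [sub_add_sub_cancel] at h1 h2
    rw [neg_sub] at h3
    omega
  have hdist' : (l1norm (x₁ - y₁) : ℝ≥0∞) ≤ l1norm (x - y) + 2 * K := by exact_mod_cast hdist
  have hpos' : (1 : ℝ≥0∞) ≤ l1norm (x - y) := by exact_mod_cast hpos
  refine ENNReal.div_le_of_le_mul ?_
  rw [hgx, hgy]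
  set B := F x₁ * (F x₀)⁻¹ * grad x₀ xstar
  set C := F y₁ * (F y₀)⁻¹ * grad y₀ ystar
  calc ν (k * B * (l * C)⁻¹) = ν (k * (B * C⁻¹) * l⁻¹) := by simp [mul_assoc]
    _ ≤ ν k + ν (B * C⁻¹) + ν l⁻¹ := (hν.2.2 _ _).trans (by gcongr; exact hν.2.2 _ _)
    _ ≤ K + (M + (l1norm (x - y) + 2 * K)) + K := by
      rw [hsymm]
      gcongr
      exact (hν.mul_inv_le _ _ _ _ _ _).trans (by gcongr; exact (hFν _ _).trans hdist')
    _ = (4 * K + M) * 1 + l1norm (x - y) := by ring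
    _ ≤ (4 * K + M) * l1norm (x - y) + l1norm (x - y) := by gcongr
    _ = _ := by ring

end Defects
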